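/- The normalized vertex number satisfies a central limit theorem: for every real t, lim_{n → ∞} Σ_{k : k ≥ μ_n + t·σ_n} p_k^(n) = ∫_t^∞ e^{−u²/2}/√(2π) du; that is, (f_0(T_n) − μ_n)/σ_n converges in distribution to a standard Gaussian random variable as n → ∞. -/

import Mathlib

open Finset

/-- `p n k` is the probability `p_k^{(n)} = P(f_0(T_n) = k)` that the random convex chain
`T_n` has exactly `k` vertices (besides the two corners), given by Buchta's formula:
`p_k^{(n)} = 2^k · Σ_{i_1+⋯+i_k = n, i_j ≥ 1} Π_{j=1}^{k} i_j / (s_j (s_j + 1))`,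
where `s_j = i_1 + ⋯ + i_j`.  In particular `p 0 0 = 1` and `p n 0 = 0` for `n ≥ 1`,
and `p n k = 0` for `k > n`. -/
noncomputable def p (n k : ℕ) : ℝ :=
  2 ^ k *
    ∑ i ∈ (Fintype.piFinset fun _ : Fin k => Finset.Icc 1 n).filter
        (fun i => ∑ j, i j = n),
      ∏ j : Fin k,
        (i j : ℝ) /
          (((∑ l ∈ Finset.univ.filter (fun l => l ≤ j), i l : ℕ) : ℝ) *
            (((∑ l ∈ Finset.univ.filter (fun l => l ≤ j), i l : ℕ) : ℝ) + 1))

/-- The mean `μ_n = E f_0(T_n) = Σ_{k=1}^n k p_k^{(n)}`. -/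
noncomputable def μ (n : ℕ) : ℝ := ∑ k ∈ Finset.Icc 1 n, (k : ℝ) * p n k

/-- The variance `σ_n² = Var f_0(T_n) = Σ_{k=1}^n (k − μ_n)² p_k^{(n)}`. -/
noncomputable def σsq (n : ℕ) : ℝ := ∑ k ∈ Finset.Icc 1 n, ((k : ℝ) - μ n) ^ 2 * p n k

/-- The upper-tail probability `P((f_0(T_n) − μ_n)/σ_n ≥ t) = Σ_{k ≥ μ_n + t σ_n} p_k^{(n)}`. -/
noncomputable def tailProb (n : ℕ) (t : ℝ) : ℝ :=
  ∑ k ∈ (Finset.Icc 1 n).filter (fun k : ℕ => μ n + t * Real.sqrt (σsq n) ≤ (k : ℝ)), p n k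

theorem Fin.sum_filter_le_castSucc {M : Type*} [AddCommMonoid M] {k : ℕ} (f : Fin (k + 1) → M)
    (j : Fin k) :
    ∑ l ∈ Finset.univ.filter (fun l => l ≤ j.castSucc), f l =
      ∑ l ∈ Finset.univ.filter (fun l => l ≤ j), f l.castSucc := by
  rw [Finset.sum_filter, Finset.sum_filter, Fin.sum_univ_castSucc]
  simp

theorem Fin.sum_filter_le_last {M : Type*} [AddCommMonoid M] {k : ℕ} (f : Fin (k + 1) → M) :
    ∑ l ∈ Finset.univ.filter (fun l => l ≤ Fin.last k), f l = ∑ l, f l := by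
  congr 1
  ext l
  simp [Fin.le_last]

theorem p_zero_right (n : ℕ) : p n 0 = if n = 0 then 1 else 0 := by
  unfold p
  rcases Nat.eq_zero_or_pos n with rfl | hn
  · simp
  · rw [Finset.filter_false_of_mem]
    · simp [hn.ne']
    · intro i _
      simpa using hn.ne

theorem p_zero_succ (k : ℕ) : p 0 (k + 1) = 0 := by
  simp [p]

theorem p_succ_right (n k : ℕ) :
    (n : ℝ) * (n + 1) * p n (k + 1) = 2 * ∑ m ∈ Finset.range n, ((n : ℝ) - m) * p m k := by
  rcases Nat.eq_zero_or_pos n with rfl | hn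
  · simp
  have hn0 : (n : ℝ) ≠ 0 := by positivity
  have hn1 : (n : ℝ) + 1 ≠ 0 := by positivity
  unfold p
  have key : ∀ m ∈ Finset.range n, ((n : ℝ) - m) * (2 ^ k *
      ∑ i ∈ (Fintype.piFinset fun _ : Fin k => Finset.Icc 1 m).filter (fun i => ∑ j, i j = m),
      ∏ j : Fin k, (i j : ℝ) /
          (((∑ l ∈ Finset.univ.filter (fun l => l ≤ j), i l : ℕ) : ℝ) *
            (((∑ l ∈ Finset.univ.filter (fun l => l ≤ j), i l : ℕ) : ℝ) + 1))) =
      ∑ i ∈ (Fintype.piFinset fun _ : Fin k => Finset.Icc 1 m).filter (fun i => ∑ j, i j = m),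
      2 ^ k * (((n : ℝ) - m) * ∏ j : Fin k, (i j : ℝ) /
          (((∑ l ∈ Finset.univ.filter (fun l => l ≤ j), i l : ℕ) : ℝ) *
            (((∑ l ∈ Finset.univ.filter (fun l => l ≤ j), i l : ℕ) : ℝ) + 1))) := by
    intro m _
    rw [Finset.mul_sum, Finset.mul_sum]
    exact Finset.sum_congr rfl fun i _ => by ring
  rw [Finset.sum_congr rfl key, Finset.sum_sigma', Finset.mul_sum, Finset.mul_sum, Finset.mul_sum]
  refine Finset.sum_nbij' (fun i => ⟨∑ j : Fin k, i j.castSucc, fun j => i j.castSucc⟩)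
    (fun x => Fin.snoc x.2 (n - x.1)) ?_ ?_ ?_ ?_ ?_
  · intro i hi
    simp only [Finset.mem_filter, Fintype.mem_piFinset, Finset.mem_Icc] at hi
    obtain ⟨hi, hs⟩ := hi
    rw [Fin.sum_univ_castSucc] at hs
    have := hi (Fin.last k)
    simp only [Finset.mem_sigma, Finset.mem_range, Finset.mem_filter, Fintype.mem_piFinset,
      Finset.mem_Icc, and_true]
    refine ⟨by omega, fun j => ⟨(hi _).1, ?_⟩⟩
    exact Finset.single_le_sum (f := fun j : Fin k => i j.castSucc) (fun _ _ => Nat.zero_le _)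
      (Finset.mem_univ j)
  · rintro ⟨m, i⟩ hi
    simp only [Finset.mem_sigma, Finset.mem_range, Finset.mem_filter, Fintype.mem_piFinset,
      Finset.mem_Icc] at hi ⊢
    obtain ⟨hm, hi, hs⟩ := hi
    refine ⟨fun j => ?_, ?_⟩
    · refine Fin.lastCases ?_ (fun j => ?_) j
      · simp only [Fin.snoc_last]; omega
      · simp only [Fin.snoc_castSucc]
        have := hi j
        omega
    · rw [Fin.sum_univ_castSucc]
      simp only [Fin.snoc_castSucc, Fin.snoc_last, hs]
      omega
  · intro i hi
    simp only [Finset.mem_filter] at hi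
    have hs := hi.2
    rw [Fin.sum_univ_castSucc] at hs
    ext j
    refine Fin.lastCases ?_ (fun j => ?_) j
    · simp only [Fin.snoc_last]; omega
    · simp
  · rintro ⟨m, i⟩ hi
    simp only [Finset.mem_sigma, Finset.mem_filter] at hi
    simp [hi.2.2]
  · intro i hi
    simp only [Finset.mem_filter] at hi
    have hs := hi.2
    rw [Fin.prod_univ_castSucc]
    simp only [Fin.sum_filter_le_castSucc, Fin.sum_filter_le_last, hs]
    rw [Fin.sum_univ_castSucc] at hs
    have hs' : (n : ℝ) - (∑ j : Fin k, i j.castSucc : ℕ) = i (Fin.last k) := by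
      rw [← hs]; push_cast; ring
    rw [hs']
    field_simp
    ring

theorem p_eq_zero_of_lt {n k : ℕ} (h : n < k) : p n k = 0 := by
  induction k generalizing n with
  | zero => omega
  | succ k ih =>
    rcases Nat.eq_zero_or_pos n with rfl | hn
    · exact p_zero_succ k
    have := p_succ_right n k
    rw [Finset.sum_eq_zero fun m hm => by
      rw [ih (by have := Finset.mem_range.1 hm; omega), mul_zero], mul_zero] at this
    have hn0 : (n : ℝ) * (n + 1) ≠ 0 := by positivity
    exact (mul_eq_zero.1 this).resolve_left hn0

theorem p_nonneg (n k : ℕ) : 0 ≤ p n k := by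
  unfold p
  positivity

open Polynomial in
/-- The generating polynomial of the distribution `p n ·`. -/
noncomputable def genPoly (n : ℕ) : ℝ[X] := ∑ k ∈ Finset.range (n + 1), C (p n k) * X ^ k

open Polynomial in
theorem coeff_genPoly (n k : ℕ) : (genPoly n).coeff k = p n k := by
  unfold genPoly
  simp only [finsetSum_coeff, coeff_C_mul_X_pow]
  rw [Finset.sum_ite_eq]
  split_ifs with h
  · rfl
  · rw [p_eq_zero_of_lt]; simpa using h

open Polynomial in
theorem genPoly_eq_sum (n : ℕ) :
    ((n : ℝ[X]) * (n + 1)) * genPoly n =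
      2 * (X : ℝ[X]) * ∑ m ∈ Finset.range n, ((n : ℝ[X]) - m) * genPoly m := by
  have e1 : ((n : ℝ[X]) * (n + 1)) = C ((n : ℝ) * (n + 1)) := by simp
  have e2 : ∑ m ∈ Finset.range n, ((n : ℝ[X]) - m) * genPoly m =
      ∑ m ∈ Finset.range n, C ((n : ℝ) - m) * genPoly m := by simp
  have e3 : (2 : ℝ[X]) = C 2 := rfl
  rw [e1, e2, e3, mul_assoc]
  ext k
  rw [coeff_C_mul, coeff_C_mul, coeff_genPoly]
  cases k with
  | zero =>
    rw [mul_coeff_zero, p_zero_right]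
    split_ifs with h <;> simp [h]
  | succ k =>
    rw [coeff_X_mul, finsetSum_coeff, p_succ_right]
    simp [coeff_C_mul, coeff_genPoly, -map_sub]

theorem genPoly_zero : genPoly 0 = 1 := by
  simp [genPoly, p_zero_right]

open Polynomial in
theorem genPoly_one : genPoly 1 = X := by
  have := genPoly_eq_sum 1
  simp only [Finset.range_one, Finset.sum_singleton, genPoly_zero] at this
  have h2 : (2 : ℝ[X]) ≠ 0 := two_ne_zero
  apply mul_left_cancel₀ h2
  push_cast at this
  linear_combination this

open Polynomial in
theorem genPoly_recurrence (n : ℕ) :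
    ((n + 2 : ℝ[X]) * (n + 3)) * genPoly (n + 2) =
      (2 * (n + 1) * (n + 2) + 2 * (X : ℝ[X])) * genPoly (n + 1) - (n * (n + 1)) * genPoly n := by
  have h0 := genPoly_eq_sum n
  have h1 := genPoly_eq_sum (n + 1)
  have h2 := genPoly_eq_sum (n + 2)
  have d (c : ℝ[X]) : ∑ m ∈ Finset.range n, ((n : ℝ[X]) + c - m) * genPoly m =
      ∑ m ∈ Finset.range n, ((n : ℝ[X]) - m) * genPoly m + c * ∑ m ∈ Finset.range n, genPoly m := by
    rw [Finset.mul_sum, ← Finset.sum_add_distrib]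
    exact Finset.sum_congr rfl fun m _ => by ring
  rw [Finset.sum_range_succ] at h1
  rw [Finset.sum_range_succ, Finset.sum_range_succ] at h2
  push_cast at h0 h1 h2
  rw [d] at h1 h2
  generalize ∑ m ∈ Finset.range n, ((n : ℝ[X]) - m) * genPoly m = S at h0 h1 h2
  generalize ∑ m ∈ Finset.range n, genPoly m = T at h0 h1 h2
  generalize genPoly n = a at *
  generalize genPoly (n + 1) = b at *
  generalize genPoly (n + 2) = c at *
  generalize (n : ℝ[X]) = N at *
  linear_combination h2 - 2 * h1 + h0

open Polynomial in
theorem genPoly_eval_recurrence {A : Type*} [CommRing A] [Algebra ℝ A] (n : ℕ) (z : A) :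
    ((n + 2 : A) * (n + 3)) * aeval z (genPoly (n + 2)) =
      (2 * (n + 1) * (n + 2) + 2 * z) * aeval z (genPoly (n + 1)) -
        (n * (n + 1)) * aeval z (genPoly n) := by
  have := congrArg (aeval z) (genPoly_recurrence n)
  simpa only [map_mul, map_add, map_sub, map_natCast, map_ofNat, map_one, aeval_X] using this

open Polynomial in
theorem im_mul_im_aeval_genPoly_pos {z : ℂ} (hz : z.im ≠ 0) (n : ℕ) :
    0 < z.im * (aeval z (genPoly (n + 1)) * (starRingEnd ℂ) (aeval z (genPoly n))).im := by
  induction n with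
  | zero =>
    simpa [genPoly_zero, genPoly_one] using mul_self_pos.2 hz
  | succ n ih =>
    have h := genPoly_eval_recurrence n z
    set a := aeval z (genPoly n)
    set b := aeval z (genPoly (n + 1))
    set c := aeval z (genPoly (n + 2))
    have hb : 0 < b.re ^ 2 + b.im ^ 2 := by
      have hb0 : b ≠ 0 := by
        intro h0
        simp [h0] at ih
      have := Complex.normSq_pos.2 hb0
      rw [Complex.normSq_apply] at this
      linarith
    have hre := congrArg Complex.re h
    have him := congrArg Complex.im h
    simp at hre him ih ⊢
    have key : ((n : ℝ) + 2) * (n + 3) * (z.im * (-(c.re * b.im) + c.im * b.re)) =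
        2 * z.im ^ 2 * (b.re ^ 2 + b.im ^ 2) +
          (n * (n + 1)) * (z.im * (-(b.re * a.im) + b.im * a.re)) := by
      linear_combination z.im * b.re * him - z.im * b.im * hre
    have hz2 : 0 < z.im ^ 2 := by positivity
    have : 0 < ((n : ℝ) + 2) * (n + 3) * (z.im * (-(c.re * b.im) + c.im * b.re)) := by
      rw [key]; positivity
    exact pos_of_mul_pos_right this (by positivity)

open Polynomial in
theorem im_eq_zero_of_aeval_genPoly_eq_zero {z : ℂ} {n : ℕ} (h : aeval z (genPoly n) = 0) :
    z.im = 0 := by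
  by_contra hz
  have := im_mul_im_aeval_genPoly_pos hz n
  simp [h] at this

open Polynomial in
theorem genPoly_eval_one (n : ℕ) : (genPoly n).eval 1 = 1 := by
  induction n using Nat.twoStepInduction with
  | zero => simp [genPoly_zero]
  | one => simp [genPoly_one]
  | more n h0 h1 =>
    have h := genPoly_eval_recurrence n (1 : ℝ)
    simp only [coe_aeval_eq_eval, h0, h1] at h
    have hn : ((n : ℝ) + 2) * (n + 3) ≠ 0 := by positivity
    apply mul_left_cancel₀ hn
    linear_combination h

open Polynomial in
theorem genPoly_eval_eq_sum {A : Type*} [CommRing A] [Algebra ℝ A] (n : ℕ) (z : A) :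
    aeval z (genPoly n) = ∑ k ∈ Finset.range (n + 1), algebraMap ℝ A (p n k) * z ^ k := by
  simp [genPoly]

open Polynomial in
theorem genPoly_ne_zero (n : ℕ) : genPoly n ≠ 0 := by
  intro h
  have := genPoly_eval_one n
  simp [h] at this

open Polynomial in
theorem genPoly_root_nonpos {n : ℕ} {x : ℝ} (h : (genPoly n).IsRoot x) : x ≤ 0 := by
  by_contra! hx
  have h1 : ∀ k ∈ Finset.range (n + 1), p n k = 0 := by
    intro k hk
    have h2 : ∑ k ∈ Finset.range (n + 1), p n k * x ^ k = 0 := by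
      rw [← h.eq_zero, ← coe_aeval_eq_eval, genPoly_eval_eq_sum]
      rfl
    have h3 := (Finset.sum_eq_zero_iff_of_nonneg
      (fun k _ => mul_nonneg (p_nonneg n k) (by positivity))).1 h2 k hk
    exact (mul_eq_zero.1 h3).resolve_right (by positivity)
  apply genPoly_ne_zero n
  rw [genPoly, Finset.sum_eq_zero]
  intro k hk
  rw [h1 k hk]
  simp

open Polynomial in
theorem genPoly_splits (n : ℕ) : (genPoly n).Splits := by
  refine Splits.of_splits_map (algebraMap ℝ ℂ) (IsAlgClosed.splits _) fun z hz => ?_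
  have hz' : aeval z (genPoly n) = 0 := by
    rw [mem_roots', IsRoot.def, eval_map_algebraMap] at hz
    exact hz.2
  exact ⟨z.re, by
    apply Complex.ext <;> simp [im_eq_zero_of_aeval_genPoly_eq_zero hz']⟩

open Polynomial in
theorem exists_genPoly_eq_prod (n : ℕ) : ∃ s : Multiset ℝ, (∀ q ∈ s, 0 ≤ q ∧ q ≤ 1) ∧
    genPoly n = (s.map fun q => C (1 - q) + C q * X).prod := by
  refine ⟨(genPoly n).roots.map fun x => 1 / (1 - x), ?_, ?_⟩
  · intro q hq
    obtain ⟨x, hx, rfl⟩ := Multiset.mem_map.1 hq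
    have := genPoly_root_nonpos (isRoot_of_mem_roots hx)
    exact ⟨by apply div_nonneg <;> linarith, by rw [div_le_one] <;> linarith⟩
  · rw [Multiset.map_map]
    have h1 : ∀ x ∈ (genPoly n).roots,
        ((fun q : ℝ => C (1 - q) + C q * X) ∘ fun x => 1 / (1 - x)) x =
          C (1 / (1 - x)) * (X - C x) := by
      intro x hx
      have hx := genPoly_root_nonpos (isRoot_of_mem_roots hx)
      have hx : 1 - x ≠ 0 := by linarith
      have : 1 - 1 / (1 - x) = 1 / (1 - x) * (-x) := by field_simp; ring
      simp only [Function.comp, this, C_mul, C_neg]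
      ring
    rw [Multiset.map_congr rfl h1, Multiset.prod_map_mul]
    have h2 := (genPoly_splits n).eq_prod_roots
    have h3 := (genPoly_splits n).eval_eq_prod_roots 1
    rw [genPoly_eval_one] at h3
    have h4 : ((genPoly n).roots.map fun x => C (1 / (1 - x))).prod =
        C (genPoly n).leadingCoeff := by
      have : ((genPoly n).roots.map fun x => 1 / (1 - x)).prod = (genPoly n).leadingCoeff := by
        simp only [one_div]
        rw [Multiset.prod_map_inv]
        exact (eq_inv_of_mul_eq_one_left h3.symm).symm
      rw [← this, map_multiset_prod, Multiset.map_map]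
      rfl
    rw [h4]
    exact h2

open Polynomial in
theorem bernoulliProd_moments (s : Multiset ℝ) :
    let P := (s.map fun q => C (1 - q) + C q * X).prod
    P.eval 1 = 1 ∧ (derivative P).eval 1 = s.sum ∧
      (derivative (derivative P)).eval 1 + (derivative P).eval 1 - (derivative P).eval 1 ^ 2 =
        (s.map fun q => q * (1 - q)).sum := by
  induction s using Multiset.induction with
  | empty => simp
  | cons q s ih =>
    obtain ⟨h0, h1, h2⟩ := ih
    simp only [Multiset.map_cons, Multiset.prod_cons, Multiset.sum_cons]
    set P := (s.map fun q => C (1 - q) + C q * X).prod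
    refine ⟨?_, ?_, ?_⟩
    · simp [h0]
    · simp [h0, h1]
    · rw [← h2]
      simp [h0]
      ring

open Polynomial in
theorem genPoly_derivative_recurrence (n : ℕ) :
    ((n + 2 : ℝ) * (n + 3)) * (derivative (genPoly (n + 2))).eval 1 =
      (2 * (n + 1) * (n + 2) + 2) * (derivative (genPoly (n + 1))).eval 1 + 2 -
        (n * (n + 1)) * (derivative (genPoly n)).eval 1 := by
  have h := congrArg (fun P => (derivative P).eval 1) (genPoly_recurrence n)
  simp [genPoly_eval_one] at h
  linear_combination h

open Polynomial in
theorem genPoly_derivative_two_recurrence (n : ℕ) :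
    ((n + 2 : ℝ) * (n + 3)) * (derivative (derivative (genPoly (n + 2)))).eval 1 =
      (2 * (n + 1) * (n + 2) + 2) * (derivative (derivative (genPoly (n + 1)))).eval 1 +
        4 * (derivative (genPoly (n + 1))).eval 1 -
        (n * (n + 1)) * (derivative (derivative (genPoly n))).eval 1 := by
  have h := congrArg (fun P => (derivative (derivative P)).eval 1) (genPoly_recurrence n)
  simp at h
  linear_combination h

open Polynomial in
/-- The variance of the distribution with generating polynomial `genPoly n`. -/
noncomputable def genVar (n : ℕ) : ℝ :=
  (derivative (derivative (genPoly n))).eval 1 + (derivative (genPoly n)).eval 1 -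
    (derivative (genPoly n)).eval 1 ^ 2

open Polynomial in
theorem genPoly_derivative_increment (n : ℕ) :
    (derivative (genPoly (n + 2))).eval 1 =
      (derivative (genPoly (n + 1))).eval 1 + 2 / (3 * (n + 2)) := by
  induction n with
  | zero =>
    have h := genPoly_derivative_recurrence 0
    simp at h ⊢
    linarith
  | succ n ih =>
    have h := genPoly_derivative_recurrence (n + 1)
    push_cast at h ⊢
    have h1 : ((n : ℝ) + 1 + 2) * (n + 1 + 3) ≠ 0 := by positivity
    apply mul_left_cancel₀ h1
    rw [show n + 1 + 2 = n + 3 from rfl, show n + 1 + 1 = n + 2 from rfl] at h ⊢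
    rw [h, ih]
    field_simp
    ring

open Polynomial in
theorem genVar_increment (n : ℕ) :
    10 / (27 * ((n : ℝ) + 2)) ≤ genVar (n + 2) - genVar (n + 1) := by
  induction n with
  | zero =>
    have h := genPoly_derivative_recurrence 0
    have h' := genPoly_derivative_two_recurrence 0
    simp [genPoly_one] at h h'
    have e1 : (derivative (genPoly 2)).eval 1 = 4 / 3 := by linarith
    have e2 : (derivative (derivative (genPoly 2))).eval 1 = 2 / 3 := by linarith
    simp [genVar, e1, e2, genPoly_one]
    norm_num
  | succ n ih =>
    have h2 := genPoly_derivative_two_recurrence (n + 1)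
    have i0 := genPoly_derivative_increment n
    have i1 := genPoly_derivative_increment (n + 1)
    unfold genVar at ih ⊢
    rw [show n + 1 + 2 = n + 3 from rfl, show n + 1 + 1 = n + 2 from rfl] at *
    rw [i0] at ih h2 i1 ⊢
    rw [i1]
    generalize (derivative (genPoly (n + 1))).eval 1 = m at *
    generalize (derivative (derivative (genPoly (n + 1)))).eval 1 = a at *
    generalize (derivative (derivative (genPoly (n + 2)))).eval 1 = b at *
    generalize (derivative (derivative (genPoly (n + 3)))).eval 1 = c at *
    push_cast at *
    have hc : c = ((2 * ((n : ℝ) + 1 + 1) * (n + 1 + 2) + 2) * b +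
        4 * (m + 2 / (3 * (n + 2))) - (n + 1) * (n + 1 + 1) * a) /
          (((n : ℝ) + 1 + 2) * (n + 1 + 3)) := by
      rw [eq_div_iff (by positivity)]
      linear_combination h2
    have key : ((n : ℝ) + 3) * (n + 4) *
        ((c + (m + 2 / (3 * ((n : ℝ) + 2)) + 2 / (3 * (n + 1 + 2))) -
        (m + 2 / (3 * ((n : ℝ) + 2)) + 2 / (3 * (n + 1 + 2))) ^ 2) -
        (b + (m + 2 / (3 * ((n : ℝ) + 2))) - (m + 2 / (3 * ((n : ℝ) + 2))) ^ 2)) =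
        (n + 1) * (n + 2) * (b + (m + 2 / (3 * ((n : ℝ) + 2))) -
          (m + 2 / (3 * ((n : ℝ) + 2))) ^ 2 - (a + m - m ^ 2)) +
        (10 / 9 + 4 / 9 * (1 / (n + 2) - 1 / (n + 3))) := by
      rw [hc]
      field_simp
      ring
    have h3 : (0 : ℝ) ≤ 1 / (n + 2) - 1 / (n + 3) := by
      rw [sub_nonneg]
      apply one_div_le_one_div_of_le <;> linarith [(Nat.cast_nonneg n : (0 : ℝ) ≤ n)]
    have h4 := mul_le_mul_of_nonneg_left ih (show (0 : ℝ) ≤ (n + 1) * (n + 2) by positivity)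
    have h5 : ((n : ℝ) + 1) * (n + 2) * (10 / (27 * (n + 2))) + 10 / 9 =
        ((n : ℝ) + 3) * (n + 4) * (10 / (27 * (n + 1 + 2))) := by
      field_simp
      ring
    refine le_of_mul_le_mul_left ?_ (show (0 : ℝ) < (n + 3) * (n + 4) by positivity)
    rw [key]
    linarith

theorem genVar_tendsto : Filter.Tendsto genVar Filter.atTop Filter.atTop := by
  rw [← Filter.tendsto_add_atTop_iff_nat 1]
  have h : ∀ n : ℕ, 10 / 27 * (∑ i ∈ Finset.range (n + 1), 1 / ((i : ℝ) + 1) + -1) ≤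
      genVar (n + 1) := by
    intro n
    induction n with
    | zero => simp [genVar, genPoly_one]
    | succ n ih =>
      have := genVar_increment n
      have e : 10 / (27 * ((n : ℝ) + 2)) = 10 / 27 * (1 / ((n : ℝ) + 1 + 1)) := by
        field_simp
        ring
      rw [Finset.sum_range_succ]
      push_cast
      linarith
  refine Filter.tendsto_atTop_mono h (Filter.Tendsto.const_mul_atTop (by norm_num) ?_)
  exact Filter.tendsto_atTop_add_const_right _ _
    (Real.tendsto_sum_range_one_div_nat_succ_atTop.comp (Filter.tendsto_add_atTop_nat 1))

theorem sum_range_mul_p {n : ℕ} (hn : n ≠ 0) (f : ℕ → ℝ) :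
    ∑ k ∈ Finset.range (n + 1), f k * p n k = ∑ k ∈ Finset.Icc 1 n, f k * p n k := by
  rw [Finset.range_eq_Ico, Finset.sum_eq_sum_Ico_succ_bot (by omega), p_zero_right, if_neg hn]
  simp
  rfl

theorem sum_range_p (n : ℕ) : ∑ k ∈ Finset.range (n + 1), p n k = 1 := by
  have := genPoly_eval_one n
  rw [← Polynomial.coe_aeval_eq_eval, genPoly_eval_eq_sum] at this
  simpa using this

open Polynomial in
theorem μ_eq {n : ℕ} (hn : n ≠ 0) : μ n = (derivative (genPoly n)).eval 1 := by
  rw [μ, ← sum_range_mul_p hn, genPoly]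
  simp only [derivative_sum, eval_finsetSum]
  refine Finset.sum_congr rfl fun k _ => ?_
  rw [derivative_C_mul_X_pow]
  simp [mul_comm]

open Polynomial in
theorem σsq_eq {n : ℕ} (hn : n ≠ 0) : σsq n = genVar n := by
  have h2 : (derivative (derivative (genPoly n))).eval 1 =
      ∑ k ∈ Finset.range (n + 1), ((k : ℝ) * (k - 1)) * p n k := by
    rw [genPoly]
    simp only [derivative_sum, eval_finsetSum]
    refine Finset.sum_congr rfl fun k _ => ?_
    rw [derivative_C_mul_X_pow, derivative_C_mul_X_pow]
    cases k with
    | zero => simp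
    | succ k => simp; ring
  have h1 : μ n = ∑ k ∈ Finset.range (n + 1), (k : ℝ) * p n k := by
    rw [μ, sum_range_mul_p hn]
  rw [genVar, ← μ_eq hn, h2, σsq, ← sum_range_mul_p hn (fun k => ((k : ℝ) - μ n) ^ 2)]
  have h3 : ∑ k ∈ Finset.range (n + 1), ((k : ℝ) - μ n) ^ 2 * p n k =
      ∑ k ∈ Finset.range (n + 1), ((k : ℝ) * (k - 1)) * p n k +
        (1 - 2 * μ n) * ∑ k ∈ Finset.range (n + 1), (k : ℝ) * p n k +
        μ n ^ 2 * ∑ k ∈ Finset.range (n + 1), p n k := by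
    rw [Finset.mul_sum, Finset.mul_sum, ← Finset.sum_add_distrib, ← Finset.sum_add_distrib]
    exact Finset.sum_congr rfl fun k _ => by ring
  rw [h3, ← h1, sum_range_p]
  ring

theorem Complex.norm_exp_mul_I_sub_taylor_le {x : ℝ} (hx : |x| ≤ 1) :
    ‖Complex.exp (x * Complex.I) - (1 + x * Complex.I - x ^ 2 / 2)‖ ≤ 2 / 9 * |x| ^ 3 := by
  have hn : ‖(x : ℂ) * Complex.I‖ = |x| := by simp
  have h := Complex.exp_bound (x := x * Complex.I) (by rw [hn]; exact hx) (n := 3) (by norm_num)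
  rw [hn] at h
  have e : ∑ m ∈ Finset.range 3, ((x : ℂ) * Complex.I) ^ m / m.factorial =
      1 + x * Complex.I - x ^ 2 / 2 := by
    simp [Finset.sum_range_succ, mul_pow, Nat.factorial]
    ring
  rw [e] at h
  refine h.trans (le_of_eq ?_)
  norm_num [Nat.factorial]
  ring

theorem norm_bernoulli_charFun_sub_le {q θ : ℝ} (h0 : 0 ≤ q) (h1 : q ≤ 1) (hθ : |θ| ≤ 1) :
    ‖Complex.exp (-(q * θ * Complex.I)) * (1 - q + q * Complex.exp (θ * Complex.I)) -
      Complex.exp (-(θ ^ 2 / 2 * (q * (1 - q))))‖ ≤ |θ| ^ 3 * (q * (1 - q)) := by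
  have hθ0 := abs_nonneg θ
  have a1 : |-(q * θ)| = q * |θ| := by rw [abs_neg, abs_mul, abs_of_nonneg h0]
  have a2 : |(1 - q) * θ| = (1 - q) * |θ| := by rw [abs_mul, abs_of_nonneg (by linarith)]
  have b1 := Complex.norm_exp_mul_I_sub_taylor_le (x := -(q * θ)) (by rw [a1]; nlinarith)
  have b2 := Complex.norm_exp_mul_I_sub_taylor_le (x := (1 - q) * θ) (by rw [a2]; nlinarith)
  rw [a1] at b1
  rw [a2] at b2
  have hq : 0 ≤ q * (1 - q) := mul_nonneg h0 (by linarith)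
  have hq1 : q * (1 - q) ≤ 1 := by nlinarith
  have hθ2 : |θ| ^ 2 ≤ 1 := by nlinarith
  have hnorm : ‖-((θ : ℂ) ^ 2 / 2 * (q * (1 - q)))‖ = |θ| ^ 2 / 2 * (q * (1 - q)) := by
    have : -((θ : ℂ) ^ 2 / 2 * (q * (1 - q))) = ((-(θ ^ 2 / 2 * (q * (1 - q))) : ℝ) : ℂ) := by
      push_cast; ring
    rw [this, Complex.norm_real, Real.norm_eq_abs, abs_neg, abs_mul, abs_of_nonneg hq, abs_div,
      abs_pow]
    norm_num
  have b3 := Complex.norm_exp_sub_one_sub_id_le (x := -((θ : ℂ) ^ 2 / 2 * (q * (1 - q))))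
    (by rw [hnorm]; nlinarith [mul_le_one₀ hθ2 hq hq1])
  rw [hnorm] at b3
  have e : Complex.exp (-(q * θ * Complex.I)) * (1 - q + q * Complex.exp (θ * Complex.I)) -
      Complex.exp (-(θ ^ 2 / 2 * (q * (1 - q)))) =
      ((1 - q : ℝ) : ℂ) * (Complex.exp (((-(q * θ) : ℝ) : ℂ) * Complex.I) -
        (1 + ((-(q * θ) : ℝ) : ℂ) * Complex.I - ((-(q * θ) : ℝ) : ℂ) ^ 2 / 2)) +
      (q : ℂ) * (Complex.exp ((((1 - q) * θ : ℝ) : ℂ) * Complex.I) -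
        (1 + (((1 - q) * θ : ℝ) : ℂ) * Complex.I - (((1 - q) * θ : ℝ) : ℂ) ^ 2 / 2)) -
      (Complex.exp (-((θ : ℂ) ^ 2 / 2 * (q * (1 - q)))) - 1 - -((θ : ℂ) ^ 2 / 2 * (q * (1 - q)))) := by
    have e1 : Complex.exp ((((1 - q) * θ : ℝ) : ℂ) * Complex.I) =
        Complex.exp (-(q * θ * Complex.I)) * Complex.exp (θ * Complex.I) := by
      rw [← Complex.exp_add]; congr 1; push_cast; ring
    have e2 : Complex.exp (((-(q * θ) : ℝ) : ℂ) * Complex.I) =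
        Complex.exp (-(q * θ * Complex.I)) := by
      congr 1; push_cast; ring
    rw [e1, e2]
    push_cast
    ring
  rw [e]
  grw [norm_sub_le, norm_add_le]
  rw [norm_mul, norm_mul, Complex.norm_real, Complex.norm_real, Real.norm_of_nonneg h0,
    Real.norm_of_nonneg (by linarith : 0 ≤ 1 - q)]
  have c1 := mul_le_mul_of_nonneg_left b1 (by linarith : 0 ≤ 1 - q)
  have c2 := mul_le_mul_of_nonneg_left b2 h0
  have hθ3 : 0 ≤ |θ| ^ 3 := by positivity
  have c3 : (1 - q) * (2 / 9 * (q * |θ|) ^ 3) + q * (2 / 9 * ((1 - q) * |θ|) ^ 3) ≤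
      2 / 9 * (|θ| ^ 3 * (q * (1 - q))) := by
    have : q ^ 2 + (1 - q) ^ 2 ≤ 1 := by nlinarith
    have := mul_le_mul_of_nonneg_left this (mul_nonneg hθ3 hq)
    nlinarith
  have c4 : (|θ| ^ 2 / 2 * (q * (1 - q))) ^ 2 ≤ 1 / 4 * (|θ| ^ 3 * (q * (1 - q))) := by
    have := mul_le_mul_of_nonneg_left (mul_le_one₀ hθ hq hq1) (mul_nonneg hθ3 hq)
    nlinarith
  have c5 := mul_nonneg hθ3 hq
  linarith

theorem norm_bernoulli_charFun_le_one {q θ : ℝ} (h0 : 0 ≤ q) (h1 : q ≤ 1) :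
    ‖Complex.exp (-(q * θ * Complex.I)) * (1 - q + q * Complex.exp (θ * Complex.I))‖ ≤ 1 := by
  have e : Complex.exp (-(q * θ * Complex.I)) = Complex.exp (((-(q * θ) : ℝ) : ℂ) * Complex.I) := by
    congr 1; push_cast; ring
  rw [norm_mul, e, Complex.norm_exp_ofReal_mul_I, one_mul]
  refine (norm_add_le _ _).trans ?_
  have : (1 - q : ℂ) = ((1 - q : ℝ) : ℂ) := by push_cast; ring
  rw [norm_mul, Complex.norm_exp_ofReal_mul_I, this, Complex.norm_real, Complex.norm_real,
    Real.norm_of_nonneg h0, Real.norm_of_nonneg (by linarith : 0 ≤ 1 - q)]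
  linarith

theorem norm_bernoulliProd_charFun_sub_le {s : Multiset ℝ} (hs : ∀ q ∈ s, 0 ≤ q ∧ q ≤ 1)
    {θ : ℝ} (hθ : |θ| ≤ 1) :
    ‖Complex.exp (-(s.sum * θ * Complex.I)) *
        (s.map fun q : ℝ => (1 - q + q * Complex.exp (θ * Complex.I) : ℂ)).prod‖ ≤ 1 ∧
    ‖Complex.exp (-(s.sum * θ * Complex.I)) *
        (s.map fun q : ℝ => (1 - q + q * Complex.exp (θ * Complex.I) : ℂ)).prod -
      Complex.exp (-(θ ^ 2 / 2 * ((s.map fun q => q * (1 - q)).sum : ℝ)))‖ ≤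
        |θ| ^ 3 * (s.map fun q => q * (1 - q)).sum := by
  induction s using Multiset.induction with
  | empty => simp
  | cons q s ih =>
    obtain ⟨i1, i2⟩ := ih fun r hr => hs r (Multiset.mem_cons_of_mem hr)
    obtain ⟨h0, h1⟩ := hs q (Multiset.mem_cons_self q s)
    have f1 := norm_bernoulli_charFun_le_one (θ := θ) h0 h1
    have f2 := norm_bernoulli_charFun_sub_le h0 h1 hθ
    simp only [Multiset.map_cons, Multiset.prod_cons, Multiset.sum_cons]
    set V : ℝ := (s.map fun q => q * (1 - q)).sum
    set Q : ℂ := (s.map fun q : ℝ => (1 - q + q * Complex.exp (θ * Complex.I) : ℂ)).prod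
    have e1 : Complex.exp (-(((q + s.sum : ℝ) : ℂ) * θ * Complex.I)) =
        Complex.exp (-(q * θ * Complex.I)) * Complex.exp (-(s.sum * θ * Complex.I)) := by
      rw [← Complex.exp_add]; congr 1; push_cast; ring
    have e2 : Complex.exp (-(θ ^ 2 / 2 * ((q * (1 - q) + V : ℝ) : ℂ))) =
        Complex.exp (-(θ ^ 2 / 2 * (q * (1 - q)))) * Complex.exp (-(θ ^ 2 / 2 * V)) := by
      rw [← Complex.exp_add]; congr 1; push_cast; ring
    have f3 : ‖Complex.exp (-(θ ^ 2 / 2 * (q * (1 - q) : ℂ)))‖ ≤ 1 := by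
      have : -((θ : ℂ) ^ 2 / 2 * (q * (1 - q))) = ((-(θ ^ 2 / 2 * (q * (1 - q))) : ℝ) : ℂ) := by
        push_cast; ring
      rw [this, Complex.norm_exp_ofReal, Real.exp_le_one_iff, neg_nonpos]
      exact mul_nonneg (by positivity) (mul_nonneg h0 (by linarith))
    rw [e1, e2]
    set f := 1 - (q : ℂ) + q * Complex.exp (θ * Complex.I)
    set a := Complex.exp (-(q * θ * Complex.I))
    set b := Complex.exp (-(s.sum * θ * Complex.I))
    set g := Complex.exp (-(θ ^ 2 / 2 * (q * (1 - q))))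
    set w := Complex.exp (-(θ ^ 2 / 2 * V))
    constructor
    · rw [show a * b * (f * Q) = (a * f) * (b * Q) by ring, norm_mul]
      exact mul_le_one₀ f1 (norm_nonneg _) i1
    · rw [show a * b * (f * Q) - g * w = (a * f - g) * (b * Q) + g * (b * Q - w) by ring]
      refine (norm_add_le _ _).trans ?_
      rw [norm_mul (a * f - g), norm_mul g, mul_add (|θ| ^ 3)]
      exact add_le_add ((mul_le_of_le_one_right (norm_nonneg _) i1).trans f2)
        ((mul_le_of_le_one_left (norm_nonneg _) f3).trans i2)

open MeasureTheory

/-- The law of `(f_0(T_n) - μ_n) / σ_n`. -/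
noncomputable def normalizedLaw (n : ℕ) : Measure ℝ :=
  ∑ k ∈ Finset.range (n + 1),
    ENNReal.ofReal (p n k) • Measure.dirac (((k : ℝ) - μ n) / Real.sqrt (σsq n))

instance (n : ℕ) : IsProbabilityMeasure (normalizedLaw n) where
  measure_univ := by
    simp only [normalizedLaw, Measure.coe_finsetSum, Finset.sum_apply, Measure.smul_apply,
      measure_univ, smul_eq_mul, mul_one]
    rw [← ENNReal.ofReal_sum_of_nonneg fun k _ => p_nonneg n k, sum_range_p, ENNReal.ofReal_one]

theorem normalizedLaw_Ici {n : ℕ} (hσ : 0 < σsq n) (hn : n ≠ 0) (t : ℝ) :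
    (normalizedLaw n).real (Set.Ici t) = tailProb n t := by
  have hs := Real.sqrt_pos.2 hσ
  rw [tailProb, Finset.sum_filter]
  have e1 : ∑ k ∈ Finset.Icc 1 n, (if μ n + t * Real.sqrt (σsq n) ≤ (k : ℝ) then p n k else 0) =
      ∑ k ∈ Finset.range (n + 1),
        (if μ n + t * Real.sqrt (σsq n) ≤ (k : ℝ) then 1 else 0) * p n k := by
    rw [sum_range_mul_p hn (fun k => if μ n + t * Real.sqrt (σsq n) ≤ (k : ℝ) then 1 else 0)]
    simp
  rw [e1, Measure.real, normalizedLaw]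
  simp only [Measure.coe_finsetSum, Finset.sum_apply, Measure.smul_apply, smul_eq_mul]
  rw [ENNReal.toReal_sum fun k _ => ENNReal.mul_ne_top ENNReal.ofReal_ne_top (measure_ne_top _ _)]
  refine Finset.sum_congr rfl fun k _ => ?_
  rw [ENNReal.toReal_mul, ENNReal.toReal_ofReal (p_nonneg n k), Measure.dirac_apply' _
    measurableSet_Ici, mul_comm]
  congr 1
  have : ((k : ℝ) - μ n) / Real.sqrt (σsq n) ∈ Set.Ici t ↔
      μ n + t * Real.sqrt (σsq n) ≤ (k : ℝ) := by
    rw [Set.mem_Ici, le_div_iff₀ hs]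
    constructor <;> intro h <;> linarith
  by_cases h : μ n + t * Real.sqrt (σsq n) ≤ (k : ℝ)
  · simp [Set.indicator_of_mem (this.2 h), h]
  · simp [Set.indicator_of_notMem (mt this.1 h), h]

theorem charFun_normalizedLaw (n : ℕ) (t : ℝ) :
    charFun (normalizedLaw n) t =
      Complex.exp (-(μ n * (t / Real.sqrt (σsq n) : ℝ) * Complex.I)) *
        Polynomial.aeval (Complex.exp ((t / Real.sqrt (σsq n) : ℝ) * Complex.I)) (genPoly n) := by
  rw [charFun_apply_real, normalizedLaw, integral_finsetSum_measure]
  · rw [genPoly_eval_eq_sum, Finset.mul_sum]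
    refine Finset.sum_congr rfl fun k _ => ?_
    rw [integral_smul_measure, integral_dirac, ENNReal.toReal_ofReal (p_nonneg n k),
      Complex.real_smul, ← Complex.exp_nat_mul, mul_left_comm, ← Complex.exp_add]
    simp only [Complex.coe_algebraMap]
    congr 2
    push_cast
    ring
  · intro k _
    exact (integrable_dirac (by simp)).smul_measure ENNReal.ofReal_ne_top

theorem norm_charFun_normalizedLaw_sub_le {n : ℕ} (hn : n ≠ 0) (hσ : 0 < σsq n) {t : ℝ}
    (ht : |t / Real.sqrt (σsq n)| ≤ 1) :
    ‖charFun (normalizedLaw n) t - Complex.exp (-(t ^ 2 / 2))‖ ≤ |t| ^ 3 / Real.sqrt (σsq n) := by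
  obtain ⟨s, hs, hprod⟩ := exists_genPoly_eq_prod n
  have hmom := bernoulliProd_moments s
  simp only [← hprod] at hmom
  obtain ⟨-, h1, h2⟩ := hmom
  rw [← μ_eq hn] at h1
  have h2 : σsq n = _ := (σsq_eq hn).trans h2
  have h := (norm_bernoulliProd_charFun_sub_le hs ht).2
  rw [← h1, ← h2] at h
  have hpos := Real.sqrt_pos.2 hσ
  have hsq := Real.sq_sqrt hσ.le
  have e1 : Polynomial.aeval (Complex.exp ((t / Real.sqrt (σsq n) : ℝ) * Complex.I)) (genPoly n) =
      (s.map fun q : ℝ =>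
        (1 - q + q * Complex.exp ((t / Real.sqrt (σsq n) : ℝ) * Complex.I) : ℂ)).prod := by
    rw [hprod, map_multiset_prod, Multiset.map_map]
    congr 1
    refine Multiset.map_congr rfl fun q _ => ?_
    simp [-Complex.ofReal_div]
  have e2 : (((t / Real.sqrt (σsq n) : ℝ) : ℂ) ^ 2 / 2 * (σsq n : ℂ)) = t ^ 2 / 2 := by
    have : (t / Real.sqrt (σsq n)) ^ 2 / 2 * σsq n = t ^ 2 / 2 := by
      rw [div_pow, hsq]; field_simp
    exact_mod_cast congrArg (fun x : ℝ => (x : ℂ)) this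
  have e3 : |t / Real.sqrt (σsq n)| ^ 3 * σsq n = |t| ^ 3 / Real.sqrt (σsq n) := by
    rw [abs_div, abs_of_pos hpos]
    nth_rewrite 2 [← hsq]
    field_simp
  rw [charFun_normalizedLaw, e1, ← e3]
  rw [e2] at h
  exact h

theorem tendsto_charFun_normalizedLaw (t : ℝ) :
    Filter.Tendsto (fun n => charFun (normalizedLaw n) t) Filter.atTop
      (nhds (Complex.exp (-(t ^ 2 / 2)))) := by
  have hσ : Filter.Tendsto (fun n => Real.sqrt (σsq n)) Filter.atTop Filter.atTop := by
    refine Real.tendsto_sqrt_atTop.comp (genVar_tendsto.congr' ?_)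
    filter_upwards [Filter.eventually_ne_atTop 0] with n hn using (σsq_eq hn).symm
  rw [tendsto_iff_norm_sub_tendsto_zero]
  refine squeeze_zero' (Filter.Eventually.of_forall fun _ => norm_nonneg _) ?_
    (hσ.const_div_atTop (|t| ^ 3))
  filter_upwards [Filter.eventually_ne_atTop 0, hσ.eventually_gt_atTop 0,
    hσ.eventually_ge_atTop |t|] with n hn h0 ht
  refine norm_charFun_normalizedLaw_sub_le hn (Real.sqrt_pos.1 h0) ?_
  rwa [abs_div, abs_of_pos h0, div_le_one h0]

theorem gaussianReal_real_Ici (t : ℝ) :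
    (ProbabilityTheory.gaussianReal 0 1).real (Set.Ici t) =
      ∫ u in Set.Ioi t, Real.exp (-u ^ 2 / 2) / Real.sqrt (2 * Real.pi) := by
  rw [Measure.real, ProbabilityTheory.gaussianReal_apply_eq_integral _ one_ne_zero,
    ENNReal.toReal_ofReal
      (integral_nonneg fun x => ProbabilityTheory.gaussianPDFReal_nonneg 0 1 x),
    integral_Ici_eq_integral_Ioi]
  congr 1
  ext u
  simp [ProbabilityTheory.gaussianPDFReal, div_eq_inv_mul]

open MeasureTheory in
/-- Central limit theorem: for every real `t`,
`lim_{n→∞} P((f_0(T_n) − μ_n)/σ_n ≥ t) = ∫_t^∞ e^{−u²/2}/√(2π) du`,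
i.e. the normalized vertex number converges in distribution to a standard Gaussian. -/
theorem central_limit_theorem (t : ℝ) :
    Filter.Tendsto (fun n : ℕ => tailProb n t) Filter.atTop
      (nhds (∫ u in Set.Ioi t, Real.exp (-u ^ 2 / 2) / Real.sqrt (2 * Real.pi))) := by
  have hlim : Filter.Tendsto (β := ProbabilityMeasure ℝ)
      (fun n => ⟨normalizedLaw n, inferInstance⟩)
      Filter.atTop (nhds ⟨ProbabilityTheory.gaussianReal 0 1, inferInstance⟩) := by
    refine ProbabilityMeasure.tendsto_of_tendsto_charFun fun s => ?_
    have e : charFun (ProbabilityTheory.gaussianReal 0 1) s = Complex.exp (-(s ^ 2 / 2)) := by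
      simp [ProbabilityTheory.charFun_gaussianReal]
    simp only [ProbabilityMeasure.coe_mk, e]
    exact tendsto_charFun_normalizedLaw s
  have := ProbabilityTheory.nullSingletonClass_gaussianReal (μ := 0) (v := 1) one_ne_zero
  have h := ProbabilityMeasure.tendsto_measure_of_null_frontier_of_tendsto' hlim
    (E := Set.Ici t) (by simp)
  have h' := (ENNReal.tendsto_toReal (measure_ne_top (ProbabilityTheory.gaussianReal 0 1) _)).comp h
  have e := gaussianReal_real_Ici t
  rw [Measure.real] at e
  simp only [ProbabilityMeasure.coe_mk] at h'
  rw [e] at h'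
  refine h'.congr' ?_
  filter_upwards [Filter.eventually_ne_atTop 0, genVar_tendsto.eventually_gt_atTop 0] with n hn hv
  exact normalizedLaw_Ici (by rwa [σsq_eq hn]) hn t
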